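/- Let R be a Noetherian commutative ring, let {M_i}_{i≥1} and {N_i}_{i≥1} be projective systems of R-modules indexed by the positive integers, and let {M_i} → {N_i} be a morphism of projective systems (R-linear maps φ_i : M_i → N_i commuting with the transition maps). Suppose there exists f ∈ R that kills the kernel and the cokernel of φ_i for every i. Then f² kills the kernel and the cokernel of the induced map lim_i M_i → lim_i N_i. -/

import Mathlib

section InvLim

variable {A : Type*} [CommRing A]

/-- The inverse limit of a projective system of modules indexed by `ℕ`, realized as the submodule
of compatible sequences in the product. -/
def InvLimit (M : ℕ → Type*) [∀ n, AddCommGroup (M n)] [∀ n, Module A (M n)]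
    (f : ∀ n, M (n + 1) →ₗ[A] M n) : Submodule A (∀ n, M n) where
  carrier := {x | ∀ n, f n (x (n + 1)) = x n}
  add_mem' := by intro a b ha hb n; simp only [Pi.add_apply, map_add, ha n, hb n]
  zero_mem' := by intro n; simp
  smul_mem' := by intro c a ha n; simp only [Pi.smul_apply, map_smul, ha n]

lemma mem_invLimit {M : ℕ → Type*} [∀ n, AddCommGroup (M n)] [∀ n, Module A (M n)]
    {f : ∀ n, M (n + 1) →ₗ[A] M n} {x : ∀ n, M n} :
    x ∈ InvLimit M f ↔ ∀ n, f n (x (n + 1)) = x n := Iff.rfl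

/-- The map induced on inverse limits by a morphism of projective systems. -/
def limMap {M N : ℕ → Type*} [∀ n, AddCommGroup (M n)] [∀ n, Module A (M n)]
    [∀ n, AddCommGroup (N n)] [∀ n, Module A (N n)]
    (fM : ∀ n, M (n + 1) →ₗ[A] M n) (fN : ∀ n, N (n + 1) →ₗ[A] N n)
    (φ : ∀ n, M n →ₗ[A] N n)
    (hcomm : ∀ n, (φ n).comp (fM n) = (fN n).comp (φ (n + 1)))
    (x : ↥(InvLimit M fM)) : ↥(InvLimit N fN) :=
  ⟨fun n => φ n (x.1 n), fun n => by
    have h := LinearMap.congr_fun (hcomm n) (x.1 (n + 1))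
    simp only [LinearMap.comp_apply] at h
    rw [← h, (mem_invLimit.1 x.2) n]⟩

end InvLim

/-- Let `R` be a Noetherian commutative ring, `{M_i} → {N_i}` a morphism of
projective systems of `R`-modules such that some `f ∈ R` kills the kernel and cokernel of each
`φ i : M i → N i`.  Then `f²` kills the kernel and the cokernel of the induced map
`lim M → lim N`. -/
theorem sq_kills_ker_coker_of_limMap {R : Type*} [CommRing R] [IsNoetherianRing R]
    (M N : ℕ → Type*) [∀ i, AddCommGroup (M i)] [∀ i, Module R (M i)]
    [∀ i, AddCommGroup (N i)] [∀ i, Module R (N i)]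
    (fM : ∀ i, M (i + 1) →ₗ[R] M i) (fN : ∀ i, N (i + 1) →ₗ[R] N i)
    (φ : ∀ i, M i →ₗ[R] N i)
    (hcomm : ∀ i, (φ i).comp (fM i) = (fN i).comp (φ (i + 1)))
    (f : R)
    (hker : ∀ (i : ℕ) (x : M i), φ i x = 0 → f • x = 0)
    (hcoker : ∀ (i : ℕ) (y : N i), ∃ x : M i, f • y = φ i x) :
    (∀ x : ↥(InvLimit M fM), limMap fM fN φ hcomm x = 0 → f ^ 2 • x = 0) ∧
    (∀ y : ↥(InvLimit N fN), ∃ x : ↥(InvLimit M fM), f ^ 2 • y = limMap fM fN φ hcomm x) := by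
  refine ⟨fun x hx => ?_, fun y => ?_⟩
  · ext n
    have h : φ n (x.1 n) = 0 := congrFun (congrArg Subtype.val hx) n
    change f ^ 2 • x.1 n = 0
    rw [pow_two, mul_smul, hker n _ h, smul_zero]
  · choose x hx using fun i => hcoker i (y.1 i)
    have compat : ∀ i, fM i (f • x (i + 1)) = f • x i := fun i => by
      have h := hker i (fM i (x (i + 1)) - x i) (by
        have hc : φ i (fM i (x (i + 1))) = fN i (φ (i + 1) (x (i + 1))) :=
          LinearMap.congr_fun (hcomm i) (x (i + 1))
        rw [map_sub, hc, ← hx, ← hx, map_smul, mem_invLimit.1 y.2 i, sub_self])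
      rwa [smul_sub, sub_eq_zero, ← map_smul] at h
    refine ⟨⟨fun i => f • x i, compat⟩, ?_⟩
    ext n
    change f ^ 2 • y.1 n = φ n (f • x n)
    rw [map_smul, ← hx, pow_two, mul_smul]
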